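/- arXiv:2108.01503 — 3 statements merged into one kernel-verified Lean document; each statement's English description precedes it below -/
import Mathlib

section
/- Boundedness for fair termination: if a session type T is fairly terminating, then T ∈ Ind(I_T ∪ Ico_T). -/
/-- An inference system over a universe `U`: a set of rules `(premises, conclusion)`. -/
abbrev InfSys (U : Type) := Set (Set U × U)

/-- The (monotone) inference operator associated with an inference system. -/
def infOp {U : Type} (I : InfSys U) : Set U →o Set U where
  toFun X := {j | ∃ pr, pr ⊆ X ∧ (pr, j) ∈ I}
  monotone' := by
    intro X Y h j hj
    obtain ⟨pr, hpr, hr⟩ := hj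
    exact ⟨pr, hpr.trans h, hr⟩

/-- Inductive interpretation: least fixed point of the inference operator. -/
def Ind {U : Type} (I : InfSys U) : Set U := OrderHom.lfp (infOp I)

/-- Coinductive interpretation: greatest fixed point of the inference operator. -/
def CoInd {U : Type} (I : InfSys U) : Set U := OrderHom.gfp (infOp I)

/-- Interpretation of a generalized inference system `(I, Ico)`: the greatest
post-fixed point of `infOp I` included in `Ind (I ∪ Ico)`, i.e. the union of
all `X` with `X ⊆ infOp I X` and `X ⊆ Ind (I ∪ Ico)`. -/
def Gen {U : Type} (I Ico : InfSys U) : Set U :=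
  sSup {X | X ⊆ infOp I X ∧ X ⊆ Ind (I ∪ Ico)}

/-- Tags for the three constructors of session types. -/
inductive STag : Type | nil | inp | out

/-- The polynomial functor `X ↦ Unit ⊕ (V → X) ⊕ (V → X)`. -/
def STF (V : Type) : PFunctor.{0} := ⟨STag, fun t => match t with
  | .nil => Empty
  | .inp => V
  | .out => V⟩

/-- Session types over `V`: the final coalgebra (M-type) of `STF V`. -/
def SessionType (V : Type) : Type := (STF V).M

/-- The `nil` session type. -/
def SessionType.nil (V : Type) : SessionType V := PFunctor.M.mk ⟨STag.nil, Empty.elim⟩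

/-- Input session type. -/
def SessionType.inp {V : Type} (f : V → SessionType V) : SessionType V :=
  PFunctor.M.mk ⟨STag.inp, f⟩

/-- Output session type. -/
def SessionType.out {V : Type} (f : V → SessionType V) : SessionType V :=
  PFunctor.M.mk ⟨STag.out, f⟩

/-- Input/output actions `?x` and `!x`. -/
inductive Act (V : Type) : Type
  | inp (x : V)
  | out (x : V)

/-- Labeled transitions of session types:
`inp f −?x→ f x` for every `x`, and `out f −!x→ f x` for every `x ∈ dom f`. -/
inductive Transition {V : Type} : SessionType V → Act V → SessionType V → Prop
  | inp (f : V → SessionType V) (x : V) : Transition (.inp f) (.inp x) (f x)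
  | out (f : V → SessionType V) (x : V) :
      f x ≠ SessionType.nil V → Transition (.out f) (.out x) (f x)

/-- `TransSeq T φ S` means `T ⇒φ S` (composite of transitions along `φ`). -/
inductive TransSeq {V : Type} : SessionType V → List (Act V) → SessionType V → Prop
  | refl (T : SessionType V) : TransSeq T [] T
  | step {T T' S : SessionType V} {α : Act V} {φ : List (Act V)} :
      Transition T α T' → TransSeq T' φ S → TransSeq T (α :: φ) S

/-- Traces of a session type: `{φ | ∃ S ≠ nil, T ⇒φ S}`. -/
def Traces {V : Type} (T : SessionType V) : Set (List (Act V)) :=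
  {φ | ∃ S, S ≠ SessionType.nil V ∧ TransSeq T φ S}

/-- Fair termination: each trace extends to a maximal one. -/
def FairlyTerminating {V : Type} (T : SessionType V) : Prop :=
  ∀ φ ∈ Traces T, ∃ ψ, (φ ++ ψ) ∈ Traces T ∧ ∀ χ, ((φ ++ ψ) ++ χ) ∈ Traces T → χ = []

/-- Rules `I_T` for fair termination (t-nil and t-all). -/
def IT (V : Type) : InfSys (SessionType V) :=
  {r | r = (∅, SessionType.nil V)} ∪
  {r | ∃ f, r = (Set.range f, SessionType.inp f)} ∪
  {r | ∃ f, r = (Set.range f, SessionType.out f)}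

/-- Corules `Ico_T` for fair termination (t-any). -/
def IcoT (V : Type) : InfSys (SessionType V) :=
  {r | ∃ f x, f x ≠ SessionType.nil V ∧ r = ({f x}, SessionType.inp f)} ∪
  {r | ∃ f x, f x ≠ SessionType.nil V ∧ r = ({f x}, SessionType.out f)}

theorem SessionType.inp_ne_nil {V : Type} (f : V → SessionType V) :
    SessionType.inp f ≠ SessionType.nil V := by
  intro h
  have h' := congrArg Sigma.fst (PFunctor.M.mk_inj h)
  cases h'

theorem SessionType.out_ne_nil {V : Type} (f : V → SessionType V) :
    SessionType.out f ≠ SessionType.nil V := by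
  intro h
  have h' := congrArg Sigma.fst (PFunctor.M.mk_inj h)
  cases h'

theorem SessionType.eq_nil_or_inp_or_out {V : Type} (T : SessionType V) :
    T = SessionType.nil V ∨ (∃ f, T = SessionType.inp f) ∨ ∃ f, T = SessionType.out f := by
  rw [← PFunctor.M.mk_dest T]
  rcases PFunctor.M.dest T with ⟨_ | _ | _, f⟩
  · left
    have hf : f = Empty.elim := funext fun x => Empty.elim x
    rw [hf]
    rfl
  · exact Or.inr (Or.inl ⟨f, rfl⟩)
  · exact Or.inr (Or.inr ⟨f, rfl⟩)

theorem Transition.ne_nil {V : Type} {T S : SessionType V} {α : Act V}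
    (h : Transition T α S) : T ≠ SessionType.nil V := by
  cases h with
  | inp f x => exact SessionType.inp_ne_nil f
  | out f x _ => exact SessionType.out_ne_nil f

theorem TransSeq.ne_nil {V : Type} {T S : SessionType V} {φ : List (Act V)}
    (h : TransSeq T φ S) (hS : S ≠ SessionType.nil V) : T ≠ SessionType.nil V := by
  cases h with
  | refl => exact hS
  | step ht _ => exact ht.ne_nil

theorem TransSeq.snoc {V : Type} {T S R : SessionType V} {φ : List (Act V)} {α : Act V}
    (h : TransSeq T φ S) (ht : Transition S α R) : TransSeq T (φ ++ [α]) R := by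
  induction h with
  | refl => exact .step ht (.refl _)
  | step h₁ _ ih => exact .step h₁ (ih ht)

/-- The inductive interpretation is closed under the rules. -/
theorem Ind.of_rule {U : Type} {I : InfSys U} {pr : Set U} {j : U}
    (hr : (pr, j) ∈ I) (hpr : pr ⊆ Ind I) : j ∈ Ind I :=
  (OrderHom.map_lfp (infOp I)).le ⟨pr, hpr, hr⟩

theorem nil_mem_Ind (V : Type) : SessionType.nil V ∈ Ind (IT V ∪ IcoT V) :=
  Ind.of_rule (Or.inl (Or.inl (Or.inl rfl))) (Set.empty_subset _)

/-- Membership in `Ind (IT V ∪ IcoT V)` propagates backwards along traces. -/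
theorem TransSeq.mem_Ind {V : Type} {T S : SessionType V} {φ : List (Act V)}
    (h : TransSeq T φ S) (hS : S ≠ SessionType.nil V) (hmem : S ∈ Ind (IT V ∪ IcoT V)) :
    T ∈ Ind (IT V ∪ IcoT V) := by
  induction h with
  | refl => exact hmem
  | step ht hs ih =>
    have hmem' := Set.singleton_subset_iff.2 (ih hS hmem)
    have hne := hs.ne_nil hS
    cases ht with
    | inp f x => exact Ind.of_rule (Or.inr (Or.inl ⟨f, x, hne, rfl⟩)) hmem'
    | out f x _ => exact Ind.of_rule (Or.inr (Or.inr ⟨f, x, hne, rfl⟩)) hmem'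

/-- A session type all of whose transitions lead to `nil` is in `Ind (IT V ∪ IcoT V)`. -/
theorem mem_Ind_of_forall_transition {V : Type} {S : SessionType V}
    (h : ∀ α R, Transition S α R → R = SessionType.nil V) : S ∈ Ind (IT V ∪ IcoT V) := by
  rcases S.eq_nil_or_inp_or_out with rfl | ⟨f, rfl⟩ | ⟨f, rfl⟩
  · exact nil_mem_Ind V
  · refine Ind.of_rule (Or.inl (Or.inl (Or.inr ⟨f, rfl⟩))) ?_
    rintro _ ⟨x, rfl⟩
    rw [h _ _ (.inp f x)]
    exact nil_mem_Ind V
  · refine Ind.of_rule (Or.inl (Or.inr ⟨f, rfl⟩)) ?_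
    rintro _ ⟨x, rfl⟩
    by_cases hx : f x = SessionType.nil V
    · rw [hx]
      exact nil_mem_Ind V
    · exact absurd (h _ _ (.out f x hx)) hx

/-- Boundedness for fair termination. -/
theorem stmt6 {V : Type} [Nontrivial V] (T : SessionType V)
    (h : FairlyTerminating T) :
    T ∈ Ind (IT V ∪ IcoT V) := by
  by_cases hT : T = SessionType.nil V
  · rw [hT]
    exact nil_mem_Ind V
  · obtain ⟨ψ, ⟨S, hS, hseq⟩, hmax⟩ := h [] ⟨T, hT, .refl T⟩
    refine hseq.mem_Ind hS (mem_Ind_of_forall_transition fun α R ht => ?_)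
    by_contra hR
    exact List.cons_ne_nil _ _ (hmax [α] ⟨R, hR, hseq.snoc ht⟩)
end

section
/- For all session types R and S: R is compliant with S if and only if (R, S) ∈ CoInd(I_C), the coinductive interpretation of the plain rules of the fair-compliance GIS. -/
/-- Complementary action. -/
def coAct {V : Type} : Act V → Act V
  | .inp x => .out x
  | .out x => .inp x

/-- Reduction of sessions: client and server synchronize. -/
def Red {V : Type} (p q : SessionType V × SessionType V) : Prop :=
  ∃ α, Transition p.1 (coAct α) q.1 ∧ Transition p.2 α q.2

/-- Reflexive-transitive closure of session reduction. -/
def Reds {V : Type} : SessionType V × SessionType V → SessionType V × SessionType V → Prop :=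
  Relation.ReflTransGen Red

/-- A successful session: the client is `end!` and the server has not failed. -/
def Successful {V : Type} (p : SessionType V × SessionType V) : Prop :=
  (∃ f, p.1 = SessionType.out f ∧ ∀ x, f x = SessionType.nil V) ∧ p.2 ≠ SessionType.nil V

/-- A session may succeed if it reduces to a successful one. -/
def MaySucceed {V : Type} (p : SessionType V × SessionType V) : Prop :=
  ∃ q, Reds p q ∧ Successful q

/-- `R` is compliant with `S`: every stuck reduct is successful. -/
def Compliant {V : Type} (R S : SessionType V) : Prop :=
  ∀ p, Reds (R, S) p → (∀ q, ¬ Red p q) → Successful p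

/-- `R` is fairly compliant with `S`: every reduct may succeed. -/
def FairCompliant {V : Type} (R S : SessionType V) : Prop :=
  ∀ p, Reds (R, S) p → MaySucceed p

/-- Plain rules `I_C` of the fair-compliance GIS (c-success, c-inp-out, c-out-inp). -/
def IC (V : Type) : InfSys (SessionType V × SessionType V) :=
  {r | ∃ (f : V → SessionType V) (S : SessionType V),
        (∀ x, f x = SessionType.nil V) ∧ S ≠ SessionType.nil V ∧
        r = (∅, (SessionType.out f, S))} ∪
  {r | ∃ f g, (∃ x, g x ≠ SessionType.nil V) ∧
        r = ({p | ∃ x, g x ≠ SessionType.nil V ∧ p = (f x, g x)},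
             (SessionType.inp f, SessionType.out g))} ∪
  {r | ∃ f g, (∃ x, f x ≠ SessionType.nil V) ∧
        r = ({p | ∃ x, f x ≠ SessionType.nil V ∧ p = (f x, g x)},
             (SessionType.out f, SessionType.inp g))}

/-- Corules `Ico_C` of the fair-compliance GIS (c-sync). -/
def IcoC (V : Type) : InfSys (SessionType V × SessionType V) :=
  {r | ∃ f g x, f x ≠ SessionType.nil V ∧
        r = ({(f x, g x)}, (SessionType.out f, SessionType.inp g))} ∪
  {r | ∃ f g x, g x ≠ SessionType.nil V ∧
        r = ({(f x, g x)}, (SessionType.inp f, SessionType.out g))}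

theorem SessionType.inp_injective {V : Type} {f g : V → SessionType V}
    (h : SessionType.inp f = SessionType.inp g) : f = g := by
  have h' := PFunctor.M.mk_inj h
  exact eq_of_heq (Sigma.mk.inj h').2

theorem SessionType.out_injective {V : Type} {f g : V → SessionType V}
    (h : SessionType.out f = SessionType.out g) : f = g := by
  have h' := PFunctor.M.mk_inj h
  exact eq_of_heq (Sigma.mk.inj h').2

theorem SessionType.inp_ne_out {V : Type} {f g : V → SessionType V} :
    SessionType.inp f ≠ SessionType.out g := by
  intro h
  exact STag.noConfusion (congrArg Sigma.fst (PFunctor.M.mk_inj h))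

theorem transition_inp_iff {V : Type} {T T' : SessionType V} {x : V} :
    Transition T (.inp x) T' ↔ ∃ f, T = .inp f ∧ T' = f x := by
  constructor
  · rintro ⟨⟩
    exact ⟨_, rfl, rfl⟩
  · rintro ⟨f, rfl, rfl⟩
    exact .inp f x

theorem transition_out_iff {V : Type} {T T' : SessionType V} {x : V} :
    Transition T (.out x) T' ↔ ∃ f, T = .out f ∧ f x ≠ SessionType.nil V ∧ T' = f x := by
  constructor
  · rintro (_ | ⟨f, _, hx⟩)
    exact ⟨f, rfl, hx, rfl⟩
  · rintro ⟨f, rfl, hx, rfl⟩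
    exact .out f x hx

theorem red_iff {V : Type} {p q : SessionType V × SessionType V} :
    Red p q ↔ ∃ f g x, q = (f x, g x) ∧
      ((p = (.out f, .inp g) ∧ f x ≠ SessionType.nil V) ∨
       (p = (.inp f, .out g) ∧ g x ≠ SessionType.nil V)) := by
  obtain ⟨R, S⟩ := p
  obtain ⟨R', S'⟩ := q
  constructor
  · rintro ⟨x | x, hR, hS⟩
    · obtain ⟨f, rfl, hx, rfl⟩ := transition_out_iff.1 hR
      obtain ⟨g, rfl, rfl⟩ := transition_inp_iff.1 hS
      exact ⟨f, g, x, rfl, .inl ⟨rfl, hx⟩⟩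
    · obtain ⟨f, rfl, rfl⟩ := transition_inp_iff.1 hR
      obtain ⟨g, rfl, hx, rfl⟩ := transition_out_iff.1 hS
      exact ⟨f, g, x, rfl, .inr ⟨rfl, hx⟩⟩
  · rintro ⟨f, g, x, hq, ⟨hp, hx⟩ | ⟨hp, hx⟩⟩ <;> cases hp <;> cases hq
    · exact ⟨.inp x, .out f x hx, .inp g x⟩
    · exact ⟨.out x, .inp f x, .out g x hx⟩

theorem Successful.not_red {V : Type} {p q : SessionType V × SessionType V}
    (hp : Successful p) : ¬ Red p q := by
  obtain ⟨⟨h, hh, hnil⟩, -⟩ := hp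
  intro hr
  obtain ⟨f, g, x, -, ⟨rfl, hx⟩ | ⟨rfl, -⟩⟩ := red_iff.1 hr
  · cases SessionType.out_injective hh
    exact hx (hnil x)
  · exact SessionType.inp_ne_out hh

/-- A session is derivable in one step of `IC` from `X` when it is successful, or it can reduce and
all its reducts are in `X`. -/
theorem mem_infOp_IC_iff {V : Type} {X : Set (SessionType V × SessionType V)}
    {p : SessionType V × SessionType V} :
    p ∈ infOp (IC V) X ↔ Successful p ∨ ((∃ q, Red p q) ∧ ∀ q, Red p q → q ∈ X) := by
  constructor
  · rintro ⟨pr, hpr, (⟨f, S, hf, hS, h⟩ | ⟨f, g, ⟨x, hx⟩, h⟩) | ⟨f, g, ⟨x, hx⟩, h⟩⟩ <;> cases h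
    · exact .inl ⟨⟨f, rfl, hf⟩, hS⟩
    · refine .inr ⟨⟨_, red_iff.2 ⟨f, g, x, rfl, .inr ⟨rfl, hx⟩⟩⟩, fun q hq => hpr ?_⟩
      obtain ⟨f', g', y, rfl, ⟨h, hy⟩ | ⟨h, hy⟩⟩ := red_iff.1 hq
      · exact (SessionType.inp_ne_out (Prod.ext_iff.1 h).1).elim
      · cases SessionType.inp_injective (Prod.ext_iff.1 h).1
        cases SessionType.out_injective (Prod.ext_iff.1 h).2
        exact ⟨y, hy, rfl⟩
    · refine .inr ⟨⟨_, red_iff.2 ⟨f, g, x, rfl, .inl ⟨rfl, hx⟩⟩⟩, fun q hq => hpr ?_⟩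
      obtain ⟨f', g', y, rfl, ⟨h, hy⟩ | ⟨h, hy⟩⟩ := red_iff.1 hq
      · cases SessionType.out_injective (Prod.ext_iff.1 h).1
        cases SessionType.inp_injective (Prod.ext_iff.1 h).2
        exact ⟨y, hy, rfl⟩
      · exact (SessionType.inp_ne_out (Prod.ext_iff.1 h).1.symm).elim
  · rintro (⟨⟨f, hf, hnil⟩, hS⟩ | ⟨⟨q, hq⟩, hX⟩)
    · refine ⟨∅, Set.empty_subset X, .inl (.inl ⟨f, p.2, hnil, hS, ?_⟩)⟩
      rw [← hf]
    · obtain ⟨f, g, x, -, ⟨rfl, hx⟩ | ⟨rfl, hx⟩⟩ := red_iff.1 hq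
      · refine ⟨_, ?_, .inr ⟨f, g, ⟨x, hx⟩, rfl⟩⟩
        rintro _ ⟨y, hy, rfl⟩
        exact hX _ (red_iff.2 ⟨f, g, y, rfl, .inl ⟨rfl, hy⟩⟩)
      · refine ⟨_, ?_, .inl (.inr ⟨f, g, ⟨x, hx⟩, rfl⟩)⟩
        rintro _ ⟨y, hy, rfl⟩
        exact hX _ (red_iff.2 ⟨f, g, y, rfl, .inr ⟨rfl, hy⟩⟩)

theorem mem_CoInd_IC_iff {V : Type} {p : SessionType V × SessionType V} :
    p ∈ CoInd (IC V) ↔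
      Successful p ∨ ((∃ q, Red p q) ∧ ∀ q, Red p q → q ∈ CoInd (IC V)) := by
  rw [← mem_infOp_IC_iff, CoInd, OrderHom.map_gfp]

theorem Reds.mem_CoInd_IC {V : Type} {p q : SessionType V × SessionType V} (h : Reds p q)
    (hp : p ∈ CoInd (IC V)) : q ∈ CoInd (IC V) := by
  induction h with
  | refl => exact hp
  | tail _ hr ih =>
    obtain hs | ⟨-, hX⟩ := mem_CoInd_IC_iff.1 ih
    · exact (hs.not_red hr).elim
    · exact hX _ hr

/-- Compliance coincides with the coinductive interpretation of the plain rules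
of the fair-compliance GIS. -/
theorem stmt10 {V : Type} [Nontrivial V] (R S : SessionType V) :
    Compliant R S ↔ (R, S) ∈ CoInd (IC V) := by
  constructor
  · intro h
    have hpost : {p : SessionType V × SessionType V | Compliant p.1 p.2} ≤
        infOp (IC V) {p | Compliant p.1 p.2} := by
      intro p hp
      refine mem_infOp_IC_iff.2 ?_
      by_cases hr : ∃ q, Red p q
      · exact .inr ⟨hr, fun q hq r hqr => hp r (Relation.ReflTransGen.head hq hqr)⟩
      · exact .inl (hp p .refl (not_exists.1 hr))
    exact OrderHom.le_gfp _ hpost h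
  · intro h p hp hstuck
    obtain hs | ⟨⟨q, hq⟩, -⟩ := mem_CoInd_IC_iff.1 (hp.mem_CoInd_IC h)
    · exact hs
    · exact (hstuck q hq).elim
end

section
/- Subject reduction for the fair-compliance GIS: if (R, S) ∈ Gen(I_C, Ico_C) and (R, S) ⇒ (R', S'), then (R', S') ∈ Gen(I_C, Ico_C). -/
namespace SessionType

variable {V : Type}

theorem inp_injective_s12 : Function.Injective (inp : (V → SessionType V) → SessionType V) := by
  intro f g h
  have h' := PFunctor.M.mk_inj h
  exact eq_of_heq (Sigma.mk.inj h').2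

theorem out_injective_s12 : Function.Injective (out : (V → SessionType V) → SessionType V) := by
  intro f g h
  have h' := PFunctor.M.mk_inj h
  exact eq_of_heq (Sigma.mk.inj h').2

theorem inp_ne_out_s12 (f g : V → SessionType V) : inp f ≠ out g := by
  intro h
  have h' := PFunctor.M.mk_inj h
  exact STag.noConfusion (Sigma.mk.inj h').1

end SessionType

theorem Transition.of_inp {V : Type} {f : V → SessionType V} {α : Act V} {T : SessionType V}
    (h : Transition (.inp f) α T) : ∃ x, α = .inp x ∧ T = f x := by
  generalize hR : SessionType.inp f = R at h
  cases h with
  | inp g x => exact ⟨x, rfl, by rw [SessionType.inp_injective_s12 hR]⟩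
  | out g x => exact (SessionType.inp_ne_out_s12 _ _ hR).elim

theorem Transition.of_out {V : Type} {f : V → SessionType V} {α : Act V} {T : SessionType V}
    (h : Transition (.out f) α T) : ∃ x, α = .out x ∧ f x ≠ SessionType.nil V ∧ T = f x := by
  generalize hR : SessionType.out f = R at h
  cases h with
  | inp g x => exact (SessionType.inp_ne_out_s12 _ _ hR.symm).elim
  | out g x hx =>
    obtain rfl := SessionType.out_injective_s12 hR
    exact ⟨x, rfl, hx, rfl⟩

/-- Every set of sessions consistent with the rules `IC V` is closed under reduction. -/
theorem Red.mem_of_subset_infOp {V : Type} {X : Set (SessionType V × SessionType V)}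
    (hX : X ⊆ infOp (IC V) X) {p q : SessionType V × SessionType V} (hp : p ∈ X)
    (hpq : Red p q) : q ∈ X := by
  obtain ⟨pr, hpr, hrule⟩ := hX hp
  obtain ⟨α, hR, hS⟩ := hpq
  obtain ⟨R, S⟩ := q
  rcases hrule with (⟨f, S, hf, -, h⟩ | ⟨f, g, -, h⟩) | ⟨f, g, -, h⟩ <;>
    obtain ⟨rfl, rfl⟩ := Prod.mk.inj h
  · obtain ⟨x, -, hx, -⟩ := hR.of_out
    exact (hx (hf x)).elim
  · obtain ⟨x, rfl, hx, rfl⟩ := hS.of_out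
    obtain ⟨y, hy, rfl⟩ := hR.of_inp
    obtain rfl := Act.inp.inj hy
    exact hpr ⟨x, hx, rfl⟩
  · obtain ⟨x, rfl, rfl⟩ := hS.of_inp
    obtain ⟨y, hy, hx, rfl⟩ := hR.of_out
    obtain rfl := Act.out.inj hy
    exact hpr ⟨x, hx, rfl⟩

/-- Subject reduction for the fair-compliance GIS. -/
theorem stmt12 {V : Type} [Nontrivial V] {R S R' S' : SessionType V}
    (h : (R, S) ∈ Gen (IC V) (IcoC V)) (hred : Reds (R, S) (R', S')) :
    (R', S') ∈ Gen (IC V) (IcoC V) := by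
  obtain ⟨X, hX, hmem⟩ := h
  refine ⟨X, hX, ?_⟩
  generalize (R', S') = q at hred ⊢
  induction hred with
  | refl => exact hmem
  | tail _ hstep ih => exact hstep.mem_of_subset_infOp hX.1 ih
end
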